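/- arXiv:1601.05542 — 3 statements merged into one kernel-verified Lean document; each statement's English description precedes it below -/
import Mathlib

section
/- Let d ≥ 1, let ψ : [0,1] → [0,∞) be measurable, 0 < β < 1, b ∈ Lip^β(ℝ^d), 1 ≤ q_2 ≤ q_1 < ∞, 0 ≤ λ ≤ 1, α_1 > −d, and let α_2 be defined by α_1 = α_2 + β + d(1/q_2 − 1/q_1). Assume either 1 ≤ p < ∞, or 0 < p < 1 and λ > 0. If ∫_0^1 t^{λ−α_1−d/q_1} (1−t)^β ψ(t) dt < ∞, then there is a constant C, independent of f, such that for all f with finite norm, ‖U^b_ψ f‖_{MK̇^{α_2,λ}_{p,q_2}(ℝ^d)} ≤ C · ‖b‖_{Lip^β} · ‖f‖_{MK̇^{α_1,λ}_{p,q_1}(ℝ^d)}, where U^b_ψ f(x) = ∫_0^1 f(tx)(b(x) − b(tx)) ψ(t) dt. -/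
open MeasureTheory ENNReal Set

noncomputable section

/-- Euclidean space `ℝ^d`. -/
abbrev Ed (d : ℕ) := EuclideanSpace ℝ (Fin d)

/-- The dyadic annulus `C_k = B_k \ B_{k-1}` where `B_k = {x : ‖x‖ ≤ 2^k}`. -/
def annulus (d : ℕ) (k : ℤ) : Set (Ed d) :=
  {x : Ed d | ‖x‖ ≤ (2 : ℝ) ^ k} \ {x : Ed d | ‖x‖ ≤ (2 : ℝ) ^ (k - 1)}

/-- `‖f χ_k‖_{q,ω} = (∫_{C_k} |f|^q ω)^{1/q}`. -/
def pieceNorm (d : ℕ) (q : ℝ) (ω : Ed d → ℝ) (f : Ed d → ℂ) (k : ℤ) : ℝ≥0∞ :=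
  (∫⁻ x in annulus d k, (‖f x‖₊ : ℝ≥0∞) ^ q * ENNReal.ofReal (ω x)) ^ (1 / q)

/-- The weighted Morrey–Herz norm `‖f‖_{MK̇^{α,lam}_{p,q}(ω)}`. -/
def morreyHerzNorm (d : ℕ) (α lam p q : ℝ) (ω : Ed d → ℝ) (f : Ed d → ℂ) : ℝ≥0∞ :=
  ⨆ k₀ : ℤ, ENNReal.ofReal ((2 : ℝ) ^ (-(k₀ : ℝ) * lam)) *
    (∑' k : {k : ℤ // k ≤ k₀},
        ENNReal.ofReal ((2 : ℝ) ^ (((k : ℤ) : ℝ) * α * p)) *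
          pieceNorm d q ω f (k : ℤ) ^ p) ^ (1 / p)

/-- The weighted homogeneous Herz norm `‖f‖_{K̇^{α,p}_q(ω)}`. -/
def herzNorm (d : ℕ) (α p q : ℝ) (ω : Ed d → ℝ) (f : Ed d → ℂ) : ℝ≥0∞ :=
  (∑' k : ℤ, ENNReal.ofReal ((2 : ℝ) ^ ((k : ℝ) * α * p)) * pieceNorm d q ω f k ^ p) ^ (1 / p)

/-- `∫_{S_d} ω dσ`, the integral of a weight over the unit sphere with respect to
the surface measure. -/
def sphereInt (d : ℕ) (ω : Ed d → ℝ) : ℝ≥0∞ :=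
  ∫⁻ θ : Metric.sphere (0 : Ed d) 1, ENNReal.ofReal (ω θ)
    ∂((volume : Measure (Ed d)).toSphere)

/-- The class `W_γ` of absolutely homogeneous weights of degree `γ`. -/
structure IsWeight (d : ℕ) (γ : ℝ) (ω : Ed d → ℝ) : Prop where
  measurable : Measurable ω
  nonneg : ∀ x, 0 ≤ ω x
  pos : ∀ᵐ x ∂(volume : Measure (Ed d)), 0 < ω x
  homog : ∀ t : ℝ, t ≠ 0 → ∀ x : Ed d, ω (t • x) = |t| ^ γ * ω x
  sphere_pos : 0 < sphereInt d ω
  sphere_lt_top : sphereInt d ω < ⊤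

/-- The unit cube `[0,1]^n`. -/
def cube (n : ℕ) : Set (Fin n → ℝ) := Set.Icc 0 1

/-- The weighted multilinear Hardy–Cesàro operator `U^{m,n}_{ψ,s}`. -/
def hardyCesaro (d m n : ℕ) (ψ : (Fin n → ℝ) → ℝ) (s : Fin m → (Fin n → ℝ) → ℝ)
    (f : Fin m → Ed d → ℂ) (x : Ed d) : ℂ :=
  ∫ t in cube n, (∏ i, f i (s i t • x)) * (ψ t : ℂ)

/-- The commutator `U^{m,n,b}_{ψ,s}` of the weighted multilinear Hardy–Cesàro operator. -/
def hardyCesaroComm (d m n : ℕ) (ψ : (Fin n → ℝ) → ℝ) (s : Fin m → (Fin n → ℝ) → ℝ)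
    (b : Fin m → Ed d → ℂ) (f : Fin m → Ed d → ℂ) (x : Ed d) : ℂ :=
  ∫ t in cube n, (∏ i, f i (s i t • x)) * (∏ i, (b i x - b i (s i t • x))) * (ψ t : ℂ)

/-- The Lipschitz seminorm `‖b‖_{Lip^β}`. -/
def lipNorm (d : ℕ) (β : ℝ) (b : Ed d → ℂ) : ℝ :=
  ⨆ pr : {pr : Ed d × Ed d // pr.1 ≠ pr.2}, ‖b pr.1.1 - b pr.1.2‖ / ‖pr.1.1 - pr.1.2‖ ^ β

/-- Membership in the Lipschitz space `Lip^β(ℝ^d)`. -/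
def MemLip (d : ℕ) (β : ℝ) (b : Ed d → ℂ) : Prop :=
  ∃ C : ℝ, ∀ x y : Ed d, ‖b x - b y‖ ≤ C * ‖x - y‖ ^ β

/-- **Minkowski's integral inequality** for nonnegative functions. -/
theorem lintegral_rpow_lintegral_le {X T : Type*} [MeasurableSpace X] [MeasurableSpace T]
    (ν : Measure X) (μ : Measure T) [SFinite ν] [SFinite μ] {p : ℝ} (hp : 1 ≤ p)
    {F : X → T → ℝ≥0∞} (hF : Measurable (Function.uncurry F)) :
    (∫⁻ x, (∫⁻ t, F x t ∂μ) ^ p ∂ν) ^ (1 / p) ≤ ∫⁻ t, (∫⁻ x, F x t ^ p ∂ν) ^ (1 / p) ∂μ := by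
  have hp0 : 0 < p := by linarith
  rcases hp.eq_or_lt with rfl | hp1
  · simp only [ENNReal.rpow_one, div_one]
    exact (lintegral_lintegral_swap hF.aemeasurable).le
  set H : T → ℝ≥0∞ := fun t => (∫⁻ x, F x t ^ p ∂ν) ^ (1 / p) with hH
  have hFp : Measurable fun z : X × T => F z.1 z.2 ^ p := hF.pow_const p
  have hHm : Measurable H := (hFp.lintegral_prod_left').pow_const _
  have hHp : ∀ t, H t ^ p = ∫⁻ x, F x t ^ p ∂ν := fun t => by
    simp only [hH]
    rw [← ENNReal.rpow_mul, one_div_mul_cancel hp0.ne', ENNReal.rpow_one]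
  by_cases hA : ∫⁻ t, H t ∂μ = ⊤
  · rw [hA]; exact le_top
  set A := ∫⁻ t, H t ∂μ
  have hHfin : ∀ᵐ t ∂μ, H t < ⊤ := ae_lt_top hHm hA
  have hzero : ∀ᵐ x ∂ν, ∀ᵐ t ∂μ, H t = 0 → F x t = 0 := by
    rw [Measure.ae_ae_comm]
    · refine Filter.Eventually.of_forall fun t => ?_
      by_cases h0 : H t = 0
      · have h1 : ∫⁻ x, F x t ^ p ∂ν = 0 := by rw [← hHp, h0, ENNReal.zero_rpow_of_pos hp0]
        rw [lintegral_eq_zero_iff (by exact hFp.comp measurable_prodMk_right)] at h1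
        filter_upwards [h1] with x hx _
        exact (ENNReal.rpow_eq_zero_iff_of_pos hp0).1 hx
      · exact Filter.Eventually.of_forall fun x h => absurd h h0
    · refine MeasurableSet.imp ?_ ?_
      · exact (hHm.comp measurable_snd) (measurableSet_singleton 0)
      · exact hF (measurableSet_singleton 0)
  set p' := p.conjExponent
  have hpq : p.HolderConjugate p' := Real.HolderConjugate.conjExponent hp1
  have hq0 : 0 < p' := hpq.symm.pos
  have key : ∀ᵐ x ∂ν, (∫⁻ t, F x t ∂μ) ^ p ≤
      (∫⁻ t, F x t ^ p * H t ^ (1 - p) ∂μ) * A ^ (p - 1) := by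
    filter_upwards [hzero] with x hx
    have hsec : Measurable (F x) := hF.comp measurable_prodMk_left
    have h1 : ∫⁻ t, F x t ∂μ =
        ∫⁻ t, ((fun t => F x t * H t ^ (-(1 / p'))) * fun t => H t ^ (1 / p')) t ∂μ := by
      refine lintegral_congr_ae ?_
      filter_upwards [hx, hHfin] with t ht htop
      by_cases h0 : H t = 0
      · simp [ht h0]
      · simp only [Pi.mul_apply]
        rw [mul_assoc, ← ENNReal.rpow_add _ _ h0 htop.ne]
        simp
    have h2 := ENNReal.lintegral_mul_le_Lp_mul_Lq μ hpq
      (f := fun t => F x t * H t ^ (-(1 / p'))) (g := fun t => H t ^ (1 / p'))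
      (hsec.mul (hHm.pow_const _)).aemeasurable (hHm.pow_const _).aemeasurable
    rw [← h1] at h2
    have h3 := ENNReal.rpow_le_rpow h2 hp0.le
    refine h3.trans (le_of_eq ?_)
    have e1 : p / p' = p - 1 := hpq.div_conj_eq_sub_one
    rw [ENNReal.mul_rpow_of_nonneg _ _ hp0.le, ← ENNReal.rpow_mul, ← ENNReal.rpow_mul,
      one_div_mul_cancel hp0.ne', ENNReal.rpow_one, one_div_mul_eq_div, e1]
    congr 1
    · refine lintegral_congr fun t => ?_
      rw [ENNReal.mul_rpow_of_nonneg _ _ hp0.le, ← ENNReal.rpow_mul]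
      congr 2
      rw [neg_mul, one_div_mul_eq_div, e1]; ring
    · congr 1
      refine lintegral_congr fun t => ?_
      rw [← ENNReal.rpow_mul, one_div_mul_cancel hq0.ne', ENNReal.rpow_one]
  have hle : ∫⁻ x, (∫⁻ t, F x t ∂μ) ^ p ∂ν ≤ A ^ p := by
    have hm2 : Measurable fun z : X × T => F z.1 z.2 ^ p * H z.2 ^ (1 - p) :=
      hFp.mul ((hHm.comp measurable_snd).pow_const _)
    calc ∫⁻ x, (∫⁻ t, F x t ∂μ) ^ p ∂ν
        ≤ ∫⁻ x, (∫⁻ t, F x t ^ p * H t ^ (1 - p) ∂μ) * A ^ (p - 1) ∂ν := lintegral_mono_ae key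
      _ = (∫⁻ x, ∫⁻ t, F x t ^ p * H t ^ (1 - p) ∂μ ∂ν) * A ^ (p - 1) :=
          lintegral_mul_const _ hm2.lintegral_prod_right'
      _ = (∫⁻ t, ∫⁻ x, F x t ^ p * H t ^ (1 - p) ∂ν ∂μ) * A ^ (p - 1) := by
          rw [lintegral_lintegral_swap hm2.aemeasurable]
      _ ≤ A * A ^ (p - 1) := by
          gcongr
          refine lintegral_mono_ae ?_
          filter_upwards [hHfin] with t htop
          have hsec : Measurable fun x => F x t ^ p := hFp.comp measurable_prodMk_right
          rw [lintegral_mul_const _ hsec, ← hHp]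
          by_cases h0 : H t = 0
          · rw [h0, ENNReal.zero_rpow_of_pos hp0, zero_mul]
          · rw [← ENNReal.rpow_add _ _ h0 htop.ne]; simp
      _ = A ^ p := by
          conv_lhs => rw [← ENNReal.rpow_one A, ← ENNReal.rpow_mul, one_mul]
          rw [← ENNReal.rpow_add_of_nonneg _ _ zero_le_one (by linarith)]; congr 1; ring
  calc _ ≤ (A ^ p) ^ (1 / p) := ENNReal.rpow_le_rpow hle (by positivity)
    _ = A := by rw [← ENNReal.rpow_mul, mul_one_div_cancel hp0.ne', ENNReal.rpow_one]

/-- Comparison of `L^q` norms on a finite measure space, for nonnegative functions. -/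
theorem lintegral_rpow_le_mul_measure_univ {X : Type*} [MeasurableSpace X] (μ : Measure X)
    {q r : ℝ} (hq : 0 < q) (hqr : q ≤ r) {g : X → ℝ≥0∞} (hg : Measurable g) :
    (∫⁻ x, g x ^ q ∂μ) ^ (1 / q) ≤
      (∫⁻ x, g x ^ r ∂μ) ^ (1 / r) * μ univ ^ (1 / q - 1 / r) := by
  simpa [eLpNorm'] using
    eLpNorm'_le_eLpNorm'_mul_rpow_measure_univ (μ := μ) hq hqr hg.aestronglyMeasurable

theorem two_rpow_mul_le {t y γ : ℝ} (ht : 0 < t) (h1 : t ≤ 2 * 2 ^ y) (h2 : (2 : ℝ) ^ y ≤ 2 * t) :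
    (2 : ℝ) ^ (y * γ) ≤ 2 ^ |γ| * t ^ γ := by
  rw [Real.rpow_mul (by norm_num)]
  rcases le_total 0 γ with h | h
  · rw [abs_of_nonneg h, ← Real.mul_rpow (by norm_num) ht.le]
    exact Real.rpow_le_rpow (by positivity) h2 h
  · rw [abs_of_nonpos h]
    have : ((2 : ℝ) ^ y) ^ γ ≤ (2⁻¹ * t) ^ γ :=
      Real.rpow_le_rpow_of_nonpos (by positivity) (by linarith) h
    rwa [Real.mul_rpow (by norm_num) ht.le, Real.inv_rpow (by norm_num),
      ← Real.rpow_neg (by norm_num)] at this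

theorem ofReal_two_rpow (x : ℝ) : ENNReal.ofReal ((2 : ℝ) ^ x) = (2 : ℝ≥0∞) ^ x := by
  rw [← ENNReal.ofReal_rpow_of_pos (by norm_num)]; norm_num

theorem two_rpow_add (x y : ℝ) : (2 : ℝ≥0∞) ^ (x + y) = 2 ^ x * 2 ^ y :=
  ENNReal.rpow_add _ _ (by norm_num) (by norm_num)

theorem measurableSet_annulus (d : ℕ) (k : ℤ) : MeasurableSet (annulus d k) :=
  (measurableSet_le measurable_norm measurable_const).diff
    (measurableSet_le measurable_norm measurable_const)

theorem volume_annulus_le (d : ℕ) (k : ℤ) :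
    volume (annulus d k) ≤ 2 ^ ((k : ℝ) * d) * volume (Metric.closedBall (0 : Ed d) 1) := by
  have hsub : annulus d k ⊆ Metric.closedBall (0 : Ed d) ((2 : ℝ) ^ k) := fun x hx => by
    simpa using hx.1
  refine (measure_mono hsub).trans ?_
  rw [Measure.addHaar_closedBall' _ _ (by positivity)]
  gcongr
  rw [← ofReal_two_rpow, Real.rpow_mul (by norm_num)]
  simp

theorem pieceNorm_one (d : ℕ) (q : ℝ) (f : Ed d → ℂ) (k : ℤ) :
    pieceNorm d q (fun _ => 1) f k = (∫⁻ x in annulus d k, ‖f x‖ₑ ^ q) ^ (1 / q) := by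
  simp [pieceNorm, enorm_eq_nnnorm]

/-- Dilation by `t ∈ (2^{n-1}, 2^n]` maps an annulus into two consecutive annuli. -/
theorem pieceNorm_comp_smul_le {d : ℕ} {q : ℝ} (hq : 1 ≤ q) {f : Ed d → ℂ} (hf : Measurable f)
    {t : ℝ} {n : ℤ} (ht1 : (2 : ℝ) ^ (n - 1) < t) (ht2 : t ≤ 2 ^ n) (k : ℤ) :
    pieceNorm d q (fun _ => 1) (fun x => f (t • x)) k ≤
      ENNReal.ofReal (t ^ (-(d : ℝ) / q)) * (pieceNorm d q (fun _ => 1) f (k + n) +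
        pieceNorm d q (fun _ => 1) f (k + n - 1)) := by
  have hq0 : 0 < q := by linarith
  have ht : 0 < t := lt_trans (by positivity) ht1
  simp only [pieceNorm_one]
  set U := annulus d (k + n) ∪ annulus d (k + n - 1)
  have hUm : MeasurableSet U := (measurableSet_annulus d _).union (measurableSet_annulus d _)
  have hmaps : ∀ x ∈ annulus d k, t • x ∈ U := fun x hx => by
    obtain ⟨hx1, hx2⟩ := hx
    simp only [mem_ofPred_eq, not_le] at hx1 hx2
    have hn : ‖t • x‖ = t * ‖x‖ := by rw [norm_smul, Real.norm_of_nonneg ht.le]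
    have h1 : ‖t • x‖ ≤ 2 ^ (k + n) := by
      rw [hn, add_comm k n, zpow_add₀ (by norm_num)]
      gcongr
    have h2 : (2 : ℝ) ^ (k + n - 1 - 1) < ‖t • x‖ := by
      rw [hn, show k + n - 1 - 1 = (n - 1) + (k - 1) by ring, zpow_add₀ (by norm_num)]
      gcongr
    by_cases h3 : ‖t • x‖ ≤ 2 ^ (k + n - 1)
    · exact Or.inr ⟨h3, not_le.2 h2⟩
    · exact Or.inl ⟨h1, h3⟩
  have hgm : Measurable fun x => ‖f x‖ₑ ^ q := hf.enorm.pow_const q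
  have hscale : ∫⁻ x in annulus d k, ‖f (t • x)‖ₑ ^ q ≤
      ENNReal.ofReal (t ^ (-(d : ℝ))) * ∫⁻ x in U, ‖f x‖ₑ ^ q := by
    calc ∫⁻ x in annulus d k, ‖f (t • x)‖ₑ ^ q
        ≤ ∫⁻ x, U.indicator (fun x => ‖f x‖ₑ ^ q) (t • x) := by
          rw [← lintegral_indicator (measurableSet_annulus d k)]
          refine lintegral_mono fun x => ?_
          by_cases hx : x ∈ annulus d k
          · rw [indicator_of_mem hx, indicator_of_mem (hmaps x hx)]
          · rw [indicator_of_notMem hx]; exact zero_le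
      _ = ∫⁻ y, U.indicator (fun x => ‖f x‖ₑ ^ q) y ∂(Measure.map (t • ·) volume) := by
          rw [lintegral_map (hgm.indicator hUm) (measurable_const_smul t)]
      _ = ENNReal.ofReal (t ^ (-(d : ℝ))) * ∫⁻ x in U, ‖f x‖ₑ ^ q := by
          rw [Measure.map_addHaar_smul _ ht.ne', lintegral_smul_measure,
            lintegral_indicator hUm, finrank_euclideanSpace_fin, abs_of_pos (by positivity),
            Real.rpow_neg ht.le, Real.rpow_natCast, smul_eq_mul]
  calc (∫⁻ x in annulus d k, ‖f (t • x)‖ₑ ^ q) ^ (1 / q)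
      ≤ (ENNReal.ofReal (t ^ (-(d : ℝ))) * ((∫⁻ x in annulus d (k + n), ‖f x‖ₑ ^ q) +
          ∫⁻ x in annulus d (k + n - 1), ‖f x‖ₑ ^ q)) ^ (1 / q) := by
        gcongr
        refine hscale.trans ?_
        gcongr
        exact lintegral_union_le _ _ _
    _ = ENNReal.ofReal (t ^ (-(d : ℝ) / q)) * ((∫⁻ x in annulus d (k + n), ‖f x‖ₑ ^ q) +
          ∫⁻ x in annulus d (k + n - 1), ‖f x‖ₑ ^ q) ^ (1 / q) := by
        rw [ENNReal.mul_rpow_of_nonneg _ _ (by positivity),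
          ENNReal.ofReal_rpow_of_pos (by positivity), ← Real.rpow_mul ht.le, mul_one_div]
    _ ≤ _ := by
        gcongr
        exact ENNReal.rpow_add_le_add_rpow _ _ (by positivity)
          (by rw [div_le_one hq0]; exact hq)

/-- A bound of Morrey type for the partial `ℓ^p` norms is inherited by two-term combinations of
translates. -/
theorem tsum_translate_add_le {p lam : ℝ} (hp : 1 ≤ p) {a : ℤ → ℝ≥0∞} {M : ℝ≥0∞}
    (hM : ∀ k₀ : ℤ, (∑' k : {k : ℤ // k ≤ k₀}, a k ^ p) ^ (1 / p) ≤ 2 ^ ((k₀ : ℝ) * lam) * M)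
    (c₀ c₁ : ℝ≥0∞) (n k₀ : ℤ) :
    (∑' k : {k : ℤ // k ≤ k₀}, (c₀ * a (k + n) + c₁ * a (k + n - 1)) ^ p) ^ (1 / p) ≤
      c₀ * (2 ^ (((k₀ + n : ℤ) : ℝ) * lam) * M) +
        c₁ * (2 ^ (((k₀ + n - 1 : ℤ) : ℝ) * lam) * M) := by
  have hp0 : 0 < p := by linarith
  have shift : ∀ (c : ℝ≥0∞) (m : ℤ),
      (∑' k : {k : ℤ // k ≤ k₀}, (c * a (k + m)) ^ p) ^ (1 / p) ≤
        c * (2 ^ (((k₀ + m : ℤ) : ℝ) * lam) * M) := fun c m => by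
    let e : {k : ℤ // k ≤ k₀} ≃ {k : ℤ // k ≤ k₀ + m} :=
      (Equiv.addRight m).subtypeEquiv fun k => by simp
    have h := e.tsum_eq fun k => a k ^ p
    simp_rw [ENNReal.mul_rpow_of_nonneg _ _ hp0.le]
    rw [ENNReal.tsum_mul_left, ENNReal.mul_rpow_of_nonneg _ _ (by positivity),
      ← ENNReal.rpow_mul, mul_one_div_cancel hp0.ne', ENNReal.rpow_one]
    gcongr
    refine le_trans (le_of_eq ?_) (hM (k₀ + m))
    rw [← h]
    rfl
  have hadd := ENNReal.lintegral_Lp_add_le (μ := Measure.count)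
    (f := fun k : {k : ℤ // k ≤ k₀} => c₀ * a (k + n))
    (g := fun k : {k : ℤ // k ≤ k₀} => c₁ * a (k + n - 1))
    (measurable_of_countable _).aemeasurable (measurable_of_countable _).aemeasurable hp
  simp only [lintegral_count, Pi.add_apply] at hadd
  refine hadd.trans (add_le_add (shift c₀ n) ?_)
  simpa only [add_sub_assoc] using shift c₁ (n - 1)

theorem dyadic_coefficients_le {α lam γ t : ℝ} {n : ℤ} (ht1 : (2 : ℝ) ^ (n - 1) < t)
    (ht2 : t ≤ 2 ^ n) (k₀ : ℤ) (M : ℝ≥0∞) :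
    ENNReal.ofReal (t ^ γ) *
      (2 ^ (-(n : ℝ) * α) * (2 ^ (((k₀ + n : ℤ) : ℝ) * lam) * M) +
        2 ^ ((1 - (n : ℝ)) * α) * (2 ^ (((k₀ + n - 1 : ℤ) : ℝ) * lam) * M)) ≤
      ENNReal.ofReal (2 * 2 ^ |lam - α|) * ENNReal.ofReal (t ^ (lam - α + γ)) *
        (2 ^ ((k₀ : ℝ) * lam) * M) := by
  have ht : 0 < t := lt_trans (by positivity) ht1
  have hz : (2 : ℝ) ^ n = 2 * 2 ^ (n - 1) := by
    rw [zpow_sub_one₀ (by norm_num)]; ring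
  have hn : (2 : ℝ) ^ (n : ℝ) = 2 ^ n := Real.rpow_intCast _ _
  have hn1 : (2 : ℝ) ^ ((n : ℝ) - 1) = 2 ^ (n - 1) := by
    rw [← Real.rpow_intCast]; push_cast; rfl
  have b0 := two_rpow_mul_le (y := n) (γ := lam - α) ht (by rw [hn]; linarith)
    (by rw [hn]; linarith)
  have b1 := two_rpow_mul_le (y := (n : ℝ) - 1) (γ := lam - α) ht (by rw [hn1]; linarith)
    (by rw [hn1]; linarith)
  have e0 : (2 : ℝ≥0∞) ^ (-(n : ℝ) * α) * (2 ^ (((k₀ + n : ℤ) : ℝ) * lam) * M) =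
      2 ^ ((n : ℝ) * (lam - α)) * (2 ^ ((k₀ : ℝ) * lam) * M) := by
    rw [← mul_assoc, ← mul_assoc, ← two_rpow_add, ← two_rpow_add]
    congr 2; push_cast; ring
  have e1 : (2 : ℝ≥0∞) ^ ((1 - (n : ℝ)) * α) * (2 ^ (((k₀ + n - 1 : ℤ) : ℝ) * lam) * M) =
      2 ^ (((n : ℝ) - 1) * (lam - α)) * (2 ^ ((k₀ : ℝ) * lam) * M) := by
    rw [← mul_assoc, ← mul_assoc, ← two_rpow_add, ← two_rpow_add]
    congr 2; push_cast; ring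
  rw [e0, e1, ← add_mul, ← mul_assoc]
  refine mul_le_mul_left ?_ _
  rw [← ofReal_two_rpow, ← ofReal_two_rpow, ← ENNReal.ofReal_add (by positivity) (by positivity),
    ← ENNReal.ofReal_mul (by positivity), ← ENNReal.ofReal_mul (by positivity)]
  refine ENNReal.ofReal_le_ofReal ?_
  rw [Real.rpow_add ht]
  calc t ^ γ * (2 ^ ((n : ℝ) * (lam - α)) + 2 ^ (((n : ℝ) - 1) * (lam - α)))
      ≤ t ^ γ * (2 ^ |lam - α| * t ^ (lam - α) + 2 ^ |lam - α| * t ^ (lam - α)) := by gcongr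
    _ = _ := by ring

theorem exists_dyadic {t : ℝ} (ht : 0 < t) : ∃ n : ℤ, (2 : ℝ) ^ (n - 1) < t ∧ t ≤ 2 ^ n := by
  obtain ⟨n, h1, h2⟩ := _root_.exists_mem_Ioc_zpow ht (one_lt_two (α := ℝ))
  exact ⟨n + 1, by simpa using h1, h2⟩

theorem weighted_pieceNorm_comp_smul_le {d : ℕ} {q α : ℝ} (hq : 1 ≤ q) {f : Ed d → ℂ}
    (hf : Measurable f) {t : ℝ} {n : ℤ} (ht1 : (2 : ℝ) ^ (n - 1) < t) (ht2 : t ≤ 2 ^ n) (k : ℤ) :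
    2 ^ ((k : ℝ) * α) * pieceNorm d q (fun _ => 1) (fun x => f (t • x)) k ≤
      ENNReal.ofReal (t ^ (-(d : ℝ) / q)) *
        (2 ^ (-(n : ℝ) * α) *
            (2 ^ (((k + n : ℤ) : ℝ) * α) * pieceNorm d q (fun _ => 1) f (k + n)) +
          2 ^ ((1 - (n : ℝ)) * α) *
            (2 ^ (((k + n - 1 : ℤ) : ℝ) * α) * pieceNorm d q (fun _ => 1) f (k + n - 1))) := by
  have e0 : (2 : ℝ≥0∞) ^ (-(n : ℝ) * α) * 2 ^ (((k + n : ℤ) : ℝ) * α) = 2 ^ ((k : ℝ) * α) := by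
    rw [← two_rpow_add]; congr 1; push_cast; ring
  have e1 : (2 : ℝ≥0∞) ^ ((1 - (n : ℝ)) * α) * 2 ^ (((k + n - 1 : ℤ) : ℝ) * α) =
      2 ^ ((k : ℝ) * α) := by
    rw [← two_rpow_add]; congr 1; push_cast; ring
  rw [← mul_assoc, ← mul_assoc, e0, e1, ← mul_add, mul_left_comm]
  gcongr
  exact pieceNorm_comp_smul_le hq hf ht1 ht2 k

theorem tsum_le_of_morreyHerzNorm {d : ℕ} {α lam p q : ℝ} (hp : 0 < p) (f : Ed d → ℂ) (k₀ : ℤ) :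
    (∑' k : {k : ℤ // k ≤ k₀},
        (2 ^ (((k : ℤ) : ℝ) * α) * pieceNorm d q (fun _ => 1) f k) ^ p) ^ (1 / p) ≤
      2 ^ ((k₀ : ℝ) * lam) * morreyHerzNorm d α lam p q (fun _ => 1) f := by
  have h := le_iSup (fun k₀ : ℤ => ENNReal.ofReal ((2 : ℝ) ^ (-(k₀ : ℝ) * lam)) *
    (∑' k : {k : ℤ // k ≤ k₀}, ENNReal.ofReal ((2 : ℝ) ^ (((k : ℤ) : ℝ) * α * p)) *
      pieceNorm d q (fun _ => 1) f (k : ℤ) ^ p) ^ (1 / p)) k₀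
  have h2 := mul_le_mul_right h (2 ^ ((k₀ : ℝ) * lam))
  refine le_trans (le_of_eq ?_) h2
  rw [← mul_assoc, ofReal_two_rpow, ← two_rpow_add]
  simp_rw [ofReal_two_rpow, ENNReal.mul_rpow_of_nonneg _ _ hp.le, ← ENNReal.rpow_mul]
  simp

theorem morreyHerzNorm_le {d : ℕ} {α lam p q : ℝ} (hp : 0 < p) {f : Ed d → ℂ} {B : ℝ≥0∞}
    (h : ∀ k₀ : ℤ, (∑' k : {k : ℤ // k ≤ k₀},
        (2 ^ (((k : ℤ) : ℝ) * α) * pieceNorm d q (fun _ => 1) f k) ^ p) ^ (1 / p) ≤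
      2 ^ ((k₀ : ℝ) * lam) * B) :
    morreyHerzNorm d α lam p q (fun _ => 1) f ≤ B := by
  refine iSup_le fun k₀ => ?_
  have h2 := mul_le_mul_right (h k₀) (2 ^ (-(k₀ : ℝ) * lam))
  rw [← mul_assoc, ← two_rpow_add] at h2
  simp_rw [ENNReal.mul_rpow_of_nonneg _ _ hp.le, ← ENNReal.rpow_mul] at h2
  simp_rw [ofReal_two_rpow]
  simpa using h2

/-- The Morrey–Herz norm controls the partial `ℓ^p` norms of dilates, `p ≥ 1`. -/
theorem tsum_comp_smul_le {d : ℕ} {α lam p q : ℝ} (hp : 1 ≤ p) (hq : 1 ≤ q) {f : Ed d → ℂ}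
    (hf : Measurable f) {t : ℝ} (ht : 0 < t) (k₀ : ℤ) :
    (∑' k : {k : ℤ // k ≤ k₀},
        (2 ^ (((k : ℤ) : ℝ) * α) *
          pieceNorm d q (fun _ => 1) (fun x => f (t • x)) k) ^ p) ^ (1 / p) ≤
      ENNReal.ofReal (2 * 2 ^ |lam - α|) * ENNReal.ofReal (t ^ (lam - α - (d : ℝ) / q)) *
        (2 ^ ((k₀ : ℝ) * lam) * morreyHerzNorm d α lam p q (fun _ => 1) f) := by
  have hp0 : 0 < p := by linarith
  obtain ⟨n, ht1, ht2⟩ := exists_dyadic ht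
  rw [sub_eq_add_neg (lam - α), ← neg_div]
  refine le_trans ?_ (dyadic_coefficients_le ht1 ht2 k₀ _)
  refine le_trans ?_ (mul_le_mul_right (tsum_translate_add_le hp
    (a := fun j => 2 ^ ((j : ℝ) * α) * pieceNorm d q (fun _ => 1) f j)
    (tsum_le_of_morreyHerzNorm hp0 f) (2 ^ (-(n : ℝ) * α)) (2 ^ ((1 - (n : ℝ)) * α)) n k₀) _)
  calc _ ≤ (∑' k : {k : ℤ // k ≤ k₀}, (ENNReal.ofReal (t ^ (-(d : ℝ) / q)) *
        (2 ^ (-(n : ℝ) * α) *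
            (2 ^ (((k + n : ℤ) : ℝ) * α) * pieceNorm d q (fun _ => 1) f (k + n)) +
          2 ^ ((1 - (n : ℝ)) * α) * (2 ^ (((k + n - 1 : ℤ) : ℝ) * α) *
            pieceNorm d q (fun _ => 1) f (k + n - 1)))) ^ p) ^ (1 / p) := by
        exact ENNReal.rpow_le_rpow (ENNReal.tsum_le_tsum fun k => ENNReal.rpow_le_rpow
          (weighted_pieceNorm_comp_smul_le hq hf ht1 ht2 k) hp0.le) (by positivity)
    _ ≤ _ := by
        simp_rw [ENNReal.mul_rpow_of_nonneg (ENNReal.ofReal (t ^ (-(d : ℝ) / q))) _ hp0.le]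
        rw [ENNReal.tsum_mul_left, ENNReal.mul_rpow_of_nonneg _ _ (by positivity),
          ← ENNReal.rpow_mul, mul_one_div_cancel hp0.ne', ENNReal.rpow_one]

/-- The Morrey–Herz norm controls every piece of a dilate. -/
theorem piece_comp_smul_le {d : ℕ} {α lam p q : ℝ} (hp : 0 < p) (hq : 1 ≤ q) {f : Ed d → ℂ}
    (hf : Measurable f) {t : ℝ} (ht : 0 < t) (k : ℤ) :
    2 ^ ((k : ℝ) * α) * pieceNorm d q (fun _ => 1) (fun x => f (t • x)) k ≤
      ENNReal.ofReal (2 * 2 ^ |lam - α|) * ENNReal.ofReal (t ^ (lam - α - (d : ℝ) / q)) *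
        (2 ^ ((k : ℝ) * lam) * morreyHerzNorm d α lam p q (fun _ => 1) f) := by
  obtain ⟨n, ht1, ht2⟩ := exists_dyadic ht
  have single : ∀ j : ℤ, 2 ^ ((j : ℝ) * α) * pieceNorm d q (fun _ => 1) f j ≤
      2 ^ ((j : ℝ) * lam) * morreyHerzNorm d α lam p q (fun _ => 1) f := fun j => by
    refine le_trans ?_ (tsum_le_of_morreyHerzNorm hp f j)
    have h := ENNReal.rpow_le_rpow (ENNReal.le_tsum (f := fun k : {k : ℤ // k ≤ j} =>
      (2 ^ (((k : ℤ) : ℝ) * α) * pieceNorm d q (fun _ => 1) f k) ^ p) ⟨j, le_rfl⟩)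
      (one_div_nonneg.2 hp.le)
    rwa [← ENNReal.rpow_mul, mul_one_div_cancel hp.ne', ENNReal.rpow_one] at h
  rw [sub_eq_add_neg (lam - α), ← neg_div]
  refine (weighted_pieceNorm_comp_smul_le hq hf ht1 ht2 k).trans
    (le_trans ?_ (dyadic_coefficients_le ht1 ht2 k _))
  exact mul_le_mul_right (add_le_add (mul_le_mul_right (single _) _)
    (mul_le_mul_right (single _) _)) _

theorem tsum_two_rpow_le_eq {s : ℝ} (k₀ : ℤ) :
    ∑' k : {k : ℤ // k ≤ k₀}, (2 : ℝ≥0∞) ^ (((k : ℤ) : ℝ) * s) =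
      2 ^ ((k₀ : ℝ) * s) * (1 - 2 ^ (-s))⁻¹ := by
  let e : ℕ ≃ {k : ℤ // k ≤ k₀} :=
    { toFun := fun i => ⟨k₀ - i, by simp⟩
      invFun := fun k => (k₀ - k).toNat
      left_inv := fun i => by simp
      right_inv := fun k => by
        ext
        have := k.2
        simp only
        omega }
  rw [← e.tsum_eq, ← ENNReal.tsum_geometric, ← ENNReal.tsum_mul_left]
  refine tsum_congr fun i => ?_
  rw [← ENNReal.rpow_natCast, ← ENNReal.rpow_mul, ← two_rpow_add]
  congr 1
  simp only [e, Equiv.coe_fn_mk]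
  push_cast
  ring

theorem norm_sub_le_lipNorm {d : ℕ} {β : ℝ} (hβ : 0 < β) {b : Ed d → ℂ} (hb : MemLip d β b)
    (x y : Ed d) : ‖b x - b y‖ ≤ lipNorm d β b * ‖x - y‖ ^ β := by
  by_cases hxy : x = y
  · simp [hxy, Real.zero_rpow hβ.ne']
  have hpos : ∀ {u v : Ed d}, u ≠ v → 0 < ‖u - v‖ ^ β := fun h =>
    Real.rpow_pos_of_pos (norm_pos_iff.2 (sub_ne_zero.2 h)) _
  obtain ⟨C, hC⟩ := hb
  have hbdd : BddAbove (range fun pr : {pr : Ed d × Ed d // pr.1 ≠ pr.2} =>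
      ‖b pr.1.1 - b pr.1.2‖ / ‖pr.1.1 - pr.1.2‖ ^ β) := by
    refine ⟨C, ?_⟩
    rintro _ ⟨pr, rfl⟩
    exact (div_le_iff₀ (hpos pr.2)).2 (hC _ _)
  exact (div_le_iff₀ (hpos hxy)).1 (le_ciSup hbdd ⟨(x, y), hxy⟩)

theorem lipNorm_nonneg (d : ℕ) (β : ℝ) (b : Ed d → ℂ) : 0 ≤ lipNorm d β b :=
  Real.iSup_nonneg fun _ => by positivity

theorem measurable_comp_smul {d : ℕ} {f : Ed d → ℂ} (hf : Measurable f) :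
    Measurable fun z : Ed d × ℝ => ‖f (z.2 • z.1)‖ₑ :=
  (hf.comp (measurable_snd.smul measurable_fst)).enorm

theorem measurable_pieceNorm_comp_smul {d : ℕ} {q : ℝ} {f : Ed d → ℂ} (hf : Measurable f)
    (k : ℤ) : Measurable fun t : ℝ => pieceNorm d q (fun _ => 1) (fun x => f (t • x)) k := by
  simp only [pieceNorm_one]
  exact (((measurable_comp_smul hf).pow_const q).lintegral_prod_left').pow_const _

/-- The commutator is dominated on `C_k` by a weighted average of dilates. -/
theorem enorm_commutator_le {d : ℕ} {ψ : ℝ → ℝ} (hψ : ∀ t, 0 ≤ ψ t) {β : ℝ} (hβ : 0 < β)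
    {b : Ed d → ℂ} (hb : MemLip d β b) (f : Ed d → ℂ) {k : ℤ} {x : Ed d} (hx : x ∈ annulus d k) :
    ‖∫ t in Icc (0 : ℝ) 1, f (t • x) * (b x - b (t • x)) * (ψ t : ℂ)‖ₑ ≤
      ∫⁻ t in Icc (0 : ℝ) 1, ENNReal.ofReal (lipNorm d β b) * 2 ^ ((k : ℝ) * β) *
        ENNReal.ofReal ((1 - t) ^ β * ψ t) * ‖f (t • x)‖ₑ := by
  refine (enorm_integral_le_lintegral_enorm _).trans (setLIntegral_mono' measurableSet_Icc ?_)
  intro t ht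
  have h1 : 0 ≤ 1 - t := by linarith [ht.2]
  have hx' : ‖x‖ ≤ (2 : ℝ) ^ (k : ℝ) := by rw [Real.rpow_intCast]; exact hx.1
  have hL := lipNorm_nonneg d β b
  have hnorm : ‖x - t • x‖ = ‖x‖ * (1 - t) := by
    rw [show x - t • x = (1 - t) • x by rw [sub_smul, one_smul], norm_smul,
      Real.norm_of_nonneg h1, mul_comm]
  have hbd : ‖b x - b (t • x)‖ ≤ lipNorm d β b * (2 ^ ((k : ℝ) * β) * (1 - t) ^ β) := by
    refine (norm_sub_le_lipNorm hβ hb x (t • x)).trans ?_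
    rw [hnorm, Real.mul_rpow (norm_nonneg _) h1, Real.rpow_mul (by norm_num)]
    gcongr
  have hbe : ‖b x - b (t • x)‖ₑ ≤ ENNReal.ofReal (lipNorm d β b) * 2 ^ ((k : ℝ) * β) *
      ENNReal.ofReal ((1 - t) ^ β) := by
    rw [← ofReal_two_rpow, mul_assoc, ← ENNReal.ofReal_mul (by positivity),
      ← ENNReal.ofReal_mul hL, ← ofReal_norm]
    exact ENNReal.ofReal_le_ofReal hbd
  have hψe : ‖(ψ t : ℂ)‖ₑ = ENNReal.ofReal (ψ t) := by
    rw [← ofReal_norm, Complex.norm_real, Real.norm_of_nonneg (hψ t)]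
  rw [enorm_mul, enorm_mul, hψe, ENNReal.ofReal_mul (by positivity)]
  calc ‖f (t • x)‖ₑ * ‖b x - b (t • x)‖ₑ * ENNReal.ofReal (ψ t)
      ≤ ‖f (t • x)‖ₑ * (ENNReal.ofReal (lipNorm d β b) * 2 ^ ((k : ℝ) * β) *
          ENNReal.ofReal ((1 - t) ^ β)) * ENNReal.ofReal (ψ t) := by gcongr
    _ = _ := by ring

theorem pieceNorm_commutator_le {d : ℕ} {ψ : ℝ → ℝ} (hψm : Measurable ψ) (hψ : ∀ t, 0 ≤ ψ t)
    {β : ℝ} (hβ : 0 < β) {b : Ed d → ℂ} (hb : MemLip d β b) {q₁ q₂ : ℝ} (hq₂ : 1 ≤ q₂)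
    (hq₁₂ : q₂ ≤ q₁) {α₁ α₂ : ℝ} (hα₂ : α₁ = α₂ + β + (d : ℝ) * (1 / q₂ - 1 / q₁))
    {f : Ed d → ℂ} (hf : Measurable f) (k : ℤ) :
    2 ^ ((k : ℝ) * α₂) * pieceNorm d q₂ (fun _ => 1)
        (fun x => ∫ t in Icc (0 : ℝ) 1, f (t • x) * (b x - b (t • x)) * (ψ t : ℂ)) k ≤
      volume (Metric.closedBall (0 : Ed d) 1) ^ (1 / q₂ - 1 / q₁) *
        ENNReal.ofReal (lipNorm d β b) *
        ∫⁻ t in Icc (0 : ℝ) 1, ENNReal.ofReal ((1 - t) ^ β * ψ t) *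
          (2 ^ ((k : ℝ) * α₁) * pieceNorm d q₁ (fun _ => 1) (fun x => f (t • x)) k) := by
  have hq0 : 0 < q₂ := by linarith
  have he : 0 ≤ 1 / q₂ - 1 / q₁ := sub_nonneg.2 (one_div_le_one_div_of_le hq0 hq₁₂)
  set e := 1 / q₂ - 1 / q₁
  set V := volume (Metric.closedBall (0 : Ed d) 1)
  set Λ := ENNReal.ofReal (lipNorm d β b)
  have hw : Measurable fun t : ℝ => ENNReal.ofReal ((1 - t) ^ β * ψ t) :=
    (((measurable_const.sub measurable_id).pow_const β).mul hψm).ennreal_ofReal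
  have hF : Measurable (Function.uncurry fun (x : Ed d) (t : ℝ) => Λ * 2 ^ ((k : ℝ) * β) *
      ENNReal.ofReal ((1 - t) ^ β * ψ t) * ‖f (t • x)‖ₑ) :=
    (measurable_const.mul (hw.comp measurable_snd)).mul (measurable_comp_smul hf)
  have hinner : ∀ t : ℝ, (∫⁻ x in annulus d k, (Λ * 2 ^ ((k : ℝ) * β) *
      ENNReal.ofReal ((1 - t) ^ β * ψ t) * ‖f (t • x)‖ₑ) ^ q₂) ^ (1 / q₂) ≤
      V ^ e * Λ * 2 ^ ((k : ℝ) * β + (k : ℝ) * d * e) * (ENNReal.ofReal ((1 - t) ^ β * ψ t) *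
        pieceNorm d q₁ (fun _ => 1) (fun x => f (t • x)) k) := fun t => by
    have hsec : Measurable fun x : Ed d => ‖f (t • x)‖ₑ :=
      (measurable_comp_smul hf).comp measurable_prodMk_right
    simp_rw [ENNReal.mul_rpow_of_nonneg (_ * _ * _) _ hq0.le]
    rw [lintegral_const_mul _ (hsec.pow_const _), ENNReal.mul_rpow_of_nonneg _ _ (by positivity),
      ← ENNReal.rpow_mul, mul_one_div_cancel hq0.ne', ENNReal.rpow_one, pieceNorm_one]
    have hH := lintegral_rpow_le_mul_measure_univ (volume.restrict (annulus d k)) hq0 hq₁₂ hsec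
    have hV : (volume.restrict (annulus d k)) univ ^ e ≤ 2 ^ ((k : ℝ) * d * e) * V ^ e := by
      rw [Measure.restrict_apply_univ, ENNReal.rpow_mul, ← ENNReal.mul_rpow_of_nonneg _ _ he]
      exact ENNReal.rpow_le_rpow (volume_annulus_le d k) he
    refine (mul_le_mul_right (hH.trans (mul_le_mul_right hV _)) _).trans (le_of_eq ?_)
    rw [two_rpow_add]
    ring
  calc _ ≤ 2 ^ ((k : ℝ) * α₂) * (∫⁻ x in annulus d k, (∫⁻ t in Icc (0 : ℝ) 1,
          Λ * 2 ^ ((k : ℝ) * β) * ENNReal.ofReal ((1 - t) ^ β * ψ t) * ‖f (t • x)‖ₑ) ^ q₂)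
            ^ (1 / q₂) := by
        rw [pieceNorm_one]
        refine mul_le_mul_right (ENNReal.rpow_le_rpow (setLIntegral_mono'
          (measurableSet_annulus d k) fun x hx => ENNReal.rpow_le_rpow
            (enorm_commutator_le hψ hβ hb f hx) hq0.le) (by positivity)) _
    _ ≤ 2 ^ ((k : ℝ) * α₂) * ∫⁻ t in Icc (0 : ℝ) 1, (∫⁻ x in annulus d k,
          (Λ * 2 ^ ((k : ℝ) * β) * ENNReal.ofReal ((1 - t) ^ β * ψ t) * ‖f (t • x)‖ₑ) ^ q₂)
            ^ (1 / q₂) :=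
        mul_le_mul_right (lintegral_rpow_lintegral_le _ _ hq₂ hF) _
    _ ≤ 2 ^ ((k : ℝ) * α₂) * ∫⁻ t in Icc (0 : ℝ) 1,
          V ^ e * Λ * 2 ^ ((k : ℝ) * β + (k : ℝ) * d * e) * (ENNReal.ofReal ((1 - t) ^ β * ψ t) *
            pieceNorm d q₁ (fun _ => 1) (fun x => f (t • x)) k) :=
        mul_le_mul_right (lintegral_mono hinner) _
    _ = _ := by
        have hm : Measurable fun t : ℝ => ENNReal.ofReal ((1 - t) ^ β * ψ t) *
            pieceNorm d q₁ (fun _ => 1) (fun x => f (t • x)) k :=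
          hw.mul (measurable_pieceNorm_comp_smul (q := q₁) hf k)
        simp_rw [mul_left_comm (ENNReal.ofReal _) ((2 : ℝ≥0∞) ^ ((k : ℝ) * α₁))]
        rw [lintegral_const_mul _ hm, lintegral_const_mul _ hm,
          show (k : ℝ) * α₁ = (k : ℝ) * α₂ + ((k : ℝ) * β + (k : ℝ) * d * e) by rw [hα₂]; ring,
          two_rpow_add ((k : ℝ) * α₂)]
        ring

/-- Boundedness of the commutator `U^b_ψ` with Lipschitz symbol between
(unweighted) Morrey–Herz spaces. -/
theorem statement9
    (d : ℕ) (hd : 1 ≤ d)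
    (ψ : ℝ → ℝ) (hψm : Measurable ψ) (hψ : ∀ t, 0 ≤ ψ t)
    (β : ℝ) (hβ : 0 < β ∧ β < 1)
    (b : Ed d → ℂ) (hb : MemLip d β b)
    (q₁ q₂ : ℝ) (hq₂ : 1 ≤ q₂) (hq₁₂ : q₂ ≤ q₁)
    (lam : ℝ) (hlam : 0 ≤ lam ∧ lam ≤ 1)
    (α₁ α₂ : ℝ) (hα₁ : -(d : ℝ) < α₁)
    (hα₂ : α₁ = α₂ + β + (d : ℝ) * (1 / q₂ - 1 / q₁))
    (p : ℝ) (hp : 1 ≤ p ∨ (0 < p ∧ p < 1 ∧ 0 < lam))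
    (hint : (∫⁻ t in Set.Icc (0 : ℝ) 1,
        ENNReal.ofReal (t ^ (lam - α₁ - (d : ℝ) / q₁) * (1 - t) ^ β * ψ t)) < ⊤) :
    ∃ C : ℝ≥0∞, C < ⊤ ∧
      ∀ f : Ed d → ℂ, Measurable f →
        morreyHerzNorm d α₁ lam p q₁ (fun _ => 1) f < ⊤ →
        morreyHerzNorm d α₂ lam p q₂ (fun _ => 1)
            (fun x => ∫ t in Set.Icc (0 : ℝ) 1, f (t • x) * (b x - b (t • x)) * (ψ t : ℂ)) ≤
          C * ENNReal.ofReal (lipNorm d β b) * morreyHerzNorm d α₁ lam p q₁ (fun _ => 1) f := by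
  have hp0 : 0 < p := hp.elim (fun h => by linarith) fun h => h.1
  have hq₁ : 1 ≤ q₁ := hq₂.trans hq₁₂
  have he : 0 ≤ 1 / q₂ - 1 / q₁ :=
    sub_nonneg.2 (one_div_le_one_div_of_le (by linarith) hq₁₂)
  set V := volume (Metric.closedBall (0 : Ed d) 1)
  set K := ENNReal.ofReal (2 * 2 ^ |lam - α₁|)
  set I := ∫⁻ t in Icc (0 : ℝ) 1,
    ENNReal.ofReal (t ^ (lam - α₁ - (d : ℝ) / q₁) * (1 - t) ^ β * ψ t)
  have hVfin : V ^ (1 / q₂ - 1 / q₁) < ⊤ :=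
    ENNReal.rpow_lt_top_of_nonneg he measure_closedBall_lt_top.ne
  have hA : V ^ (1 / q₂ - 1 / q₁) * (K * I) < ⊤ :=
    ENNReal.mul_lt_top hVfin (ENNReal.mul_lt_top ENNReal.ofReal_lt_top hint)
  have hwm : Measurable fun t : ℝ => ENNReal.ofReal ((1 - t) ^ β * ψ t) :=
    (((measurable_const.sub measurable_id).pow_const β).mul hψm).ennreal_ofReal
  have hWm : Measurable fun t : ℝ =>
      ENNReal.ofReal (t ^ (lam - α₁ - (d : ℝ) / q₁) * (1 - t) ^ β * ψ t) :=
    (((measurable_id.pow_const _).mul ((measurable_const.sub measurable_id).pow_const β)).mul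
      hψm).ennreal_ofReal
  have hint_le : ∀ (D : ℝ≥0∞) (G : ℝ → ℝ≥0∞),
      (∀ t, 0 < t → G t ≤ K * ENNReal.ofReal (t ^ (lam - α₁ - (d : ℝ) / q₁)) * D) →
      ∫⁻ t in Icc (0 : ℝ) 1, ENNReal.ofReal ((1 - t) ^ β * ψ t) * G t ≤ K * I * D := by
    intro D G hG
    calc ∫⁻ t in Icc (0 : ℝ) 1, ENNReal.ofReal ((1 - t) ^ β * ψ t) * G t
        ≤ ∫⁻ t in Icc (0 : ℝ) 1, K * D *
            ENNReal.ofReal (t ^ (lam - α₁ - (d : ℝ) / q₁) * (1 - t) ^ β * ψ t) := by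
          rw [← Measure.restrict_congr_set (Ioc_ae_eq_Icc (μ := volume))]
          refine setLIntegral_mono' measurableSet_Ioc fun t ht => ?_
          refine (mul_le_mul_right (hG t ht.1) _).trans (le_of_eq ?_)
          rw [mul_assoc (t ^ _), ENNReal.ofReal_mul (Real.rpow_nonneg ht.1.le _)]
          ring
      _ = K * I * D := by rw [lintegral_const_mul _ hWm]; ring
  have hgm : ∀ (f : Ed d → ℂ), Measurable f → ∀ k : ℤ, Measurable fun t : ℝ =>
      2 ^ ((k : ℝ) * α₁) * pieceNorm d q₁ (fun _ => 1) (fun x => f (t • x)) k :=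
    fun f hf k => measurable_const.mul (measurable_pieceNorm_comp_smul hf k)
  have hpow : ∀ c s : ℝ≥0∞, (c ^ p * s) ^ (1 / p) = c * s ^ (1 / p) := fun c s => by
    rw [ENNReal.mul_rpow_of_nonneg _ _ (by positivity), ← ENNReal.rpow_mul,
      mul_one_div_cancel hp0.ne', ENNReal.rpow_one]
  rcases hp with hp1 | ⟨-, -, hlam0⟩
  · refine ⟨V ^ (1 / q₂ - 1 / q₁) * (K * I), hA, fun f hf _ => morreyHerzNorm_le hp0 fun k₀ => ?_⟩
    set M := morreyHerzNorm d α₁ lam p q₁ (fun _ => 1) f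
    have hmink := lintegral_rpow_lintegral_le (Measure.count : Measure {k : ℤ // k ≤ k₀})
      (volume.restrict (Icc (0 : ℝ) 1)) hp1 (F := fun k t => ENNReal.ofReal ((1 - t) ^ β * ψ t) *
        (2 ^ (((k : ℤ) : ℝ) * α₁) * pieceNorm d q₁ (fun _ => 1) (fun x => f (t • x)) k))
      (measurable_from_prod_countable_right fun k => hwm.mul (hgm f hf k))
    simp only [lintegral_count] at hmink
    calc _ ≤ (∑' k : {k : ℤ // k ≤ k₀}, (V ^ (1 / q₂ - 1 / q₁) * ENNReal.ofReal (lipNorm d β b) *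
          ∫⁻ t in Icc (0 : ℝ) 1, ENNReal.ofReal ((1 - t) ^ β * ψ t) *
            (2 ^ (((k : ℤ) : ℝ) * α₁) *
              pieceNorm d q₁ (fun _ => 1) (fun x => f (t • x)) k)) ^ p) ^ (1 / p) :=
          ENNReal.rpow_le_rpow (ENNReal.tsum_le_tsum fun k => ENNReal.rpow_le_rpow
            (pieceNorm_commutator_le hψm hψ hβ.1 hb hq₂ hq₁₂ hα₂ hf k) hp0.le) (by positivity)
      _ ≤ V ^ (1 / q₂ - 1 / q₁) * ENNReal.ofReal (lipNorm d β b) *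
          (K * I * (2 ^ ((k₀ : ℝ) * lam) * M)) := by
          simp_rw [ENNReal.mul_rpow_of_nonneg (_ * ENNReal.ofReal (lipNorm d β b)) _ hp0.le]
          rw [ENNReal.tsum_mul_left, hpow]
          refine mul_le_mul_right (hmink.trans ?_) _
          simp_rw [ENNReal.mul_rpow_of_nonneg (ENNReal.ofReal _) _ hp0.le, ENNReal.tsum_mul_left,
            hpow]
          exact hint_le _ _ fun t ht => tsum_comp_smul_le hp1 hq₁ hf ht k₀
      _ = _ := by ring
  · set S := ((1 - 2 ^ (-(lam * p)))⁻¹ : ℝ≥0∞) ^ (1 / p) with hS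
    have hSfin : S < ⊤ := by
      refine ENNReal.rpow_lt_top_of_nonneg (by positivity) (ENNReal.inv_ne_top.2 ?_)
      refine (tsub_pos_of_lt ?_).ne'
      exact ENNReal.rpow_lt_one_of_one_lt_of_neg (by norm_num) (by nlinarith)
    refine ⟨S * (V ^ (1 / q₂ - 1 / q₁) * (K * I)), ENNReal.mul_lt_top hSfin hA,
      fun f hf _ => morreyHerzNorm_le hp0 fun k₀ => ?_⟩
    set M := morreyHerzNorm d α₁ lam p q₁ (fun _ => 1) f
    set B := V ^ (1 / q₂ - 1 / q₁) * (K * I) * ENNReal.ofReal (lipNorm d β b) * M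
    calc _ ≤ (∑' k : {k : ℤ // k ≤ k₀}, (B * 2 ^ (((k : ℤ) : ℝ) * lam)) ^ p) ^ (1 / p) := by
          refine ENNReal.rpow_le_rpow (ENNReal.tsum_le_tsum fun k => ENNReal.rpow_le_rpow
            ((pieceNorm_commutator_le hψm hψ hβ.1 hb hq₂ hq₁₂ hα₂ hf k).trans
              ((mul_le_mul_right (hint_le _ _ fun t ht =>
                piece_comp_smul_le hp0 hq₁ hf ht k) _).trans (le_of_eq ?_))) hp0.le)
            (by positivity)
          simp only [B]
          ring
      _ = B * (2 ^ ((k₀ : ℝ) * lam) * S) := by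
          simp_rw [ENNReal.mul_rpow_of_nonneg B _ hp0.le, ← ENNReal.rpow_mul, mul_assoc _ lam p]
          rw [ENNReal.tsum_mul_left, hpow, tsum_two_rpow_le_eq, hS, ← mul_assoc (k₀ : ℝ),
            ENNReal.rpow_mul _ _ p, hpow]
      _ = _ := by
          simp only [B]
          ring

end
end

section
/- Let d ≥ 1, γ > −d, ω ∈ W_γ, α ∈ ℝ, 0 < p < ∞, 1 ≤ q < ∞, and λ > 0 with λ ≠ α. Define f(x) = |x|^{−α−(d+γ)/q+λ} for x ∈ ℝ^d \ {0}. Then ‖f‖_{MK̇^{α,λ}_{p,q}(ω)} = (2^λ/(2^{λp}−1)^{1/p}) · ((1 − 2^{−q(λ−α)})/(q(λ−α)))^{1/q} · (∫_{S_d} ω dσ)^{1/q}. -/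
open MeasureTheory ENNReal Set

noncomputable section

/-- Integration in polar coordinates of a product of an angular and a radial function. -/
theorem lintegral_angular_mul_radial {E : Type*} [NormedAddCommGroup E] [NormedSpace ℝ E]
    [MeasurableSpace E] [BorelSpace E] [FiniteDimensional ℝ E] [Nontrivial E]
    (μ : Measure E) [μ.IsAddHaarMeasure] {G : E → ℝ≥0∞} {H : ℝ → ℝ≥0∞}
    (hG : Measurable G) (hH : Measurable H) :
    ∫⁻ x, G (‖x‖⁻¹ • x) * H ‖x‖ ∂μ =
      (∫⁻ θ : Metric.sphere (0 : E) 1, G θ ∂μ.toSphere) *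
        ∫⁻ r in Ioi (0 : ℝ), ENNReal.ofReal (r ^ (Module.finrank ℝ E - 1)) * H r := by
  calc
    _ = ∫⁻ x : ({0}ᶜ : Set E), G (‖x.1‖⁻¹ • x.1) * H ‖x.1‖ ∂(μ.comap (↑)) := by
      rw [lintegral_subtype_comap (measurableSet_singleton _).compl
        fun x : E ↦ G (‖x‖⁻¹ • x) * H ‖x‖, restrict_compl_singleton]
    _ = ∫⁻ z, G z.1 * H z.2
          ∂μ.toSphere.prod (Measure.volumeIoiPow (Module.finrank ℝ E - 1)) := by
      simpa using μ.measurePreserving_homeomorphUnitSphereProd.lintegral_comp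
        (f := fun z ↦ G z.1 * H z.2) (by fun_prop)
    _ = (∫⁻ θ : Metric.sphere (0 : E) 1, G θ ∂μ.toSphere) *
          ∫⁻ r : Ioi (0 : ℝ), H r ∂(Measure.volumeIoiPow (Module.finrank ℝ E - 1)) :=
      lintegral_prod_mul (f := fun θ : Metric.sphere (0 : E) 1 ↦ G θ)
        (g := fun r : Ioi (0 : ℝ) ↦ H r) (by fun_prop) (by fun_prop)
    _ = _ := by
      rw [Measure.volumeIoiPow, lintegral_withDensity_eq_lintegral_mul _ (by fun_prop)
        (by fun_prop), ← lintegral_subtype_comap measurableSet_Ioi]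
      rfl

/-- The integral of a power over a dyadic interval. -/
theorem lintegral_dyadic_rpow {b : ℝ} (hb : b ≠ 0) (k : ℤ) :
    ∫⁻ r in Ioc ((2 : ℝ) ^ (k - 1)) ((2 : ℝ) ^ k), ENNReal.ofReal (r ^ (b - 1)) =
      ENNReal.ofReal ((2 : ℝ) ^ ((k : ℝ) * b) * ((1 - (2 : ℝ) ^ (-b)) / b)) := by
  have h0 : (0 : ℝ) < (2 : ℝ) ^ (k - 1) := by positivity
  have hle : (2 : ℝ) ^ (k - 1) ≤ (2 : ℝ) ^ k := zpow_le_zpow_right₀ (by norm_num) (by lia)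
  have hnot : (0 : ℝ) ∉ uIcc ((2 : ℝ) ^ (k - 1)) ((2 : ℝ) ^ k) := by
    rw [uIcc_of_le hle]
    exact fun h ↦ absurd h.1 (not_le.2 h0)
  rw [← ofReal_integral_eq_lintegral_ofReal
    (intervalIntegral.intervalIntegrable_rpow (Or.inr hnot)).1,
    ← intervalIntegral.integral_of_le hle,
    integral_rpow (Or.inr ⟨fun h ↦ hb (by linarith), hnot⟩)]
  · congr 1
    rw [← Real.rpow_intCast, ← Real.rpow_intCast, sub_add_cancel, ← Real.rpow_mul two_pos.le,
      ← Real.rpow_mul two_pos.le]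
    have : ((k - 1 : ℤ) : ℝ) * b = k * b + -b := by push_cast; ring
    rw [this, Real.rpow_add two_pos]
    ring
  · filter_upwards [ae_restrict_mem measurableSet_Ioc] with r hr
    exact Real.rpow_nonneg (h0.trans hr.1).le _

theorem one_sub_two_rpow_neg_div_pos {b : ℝ} (hb : b ≠ 0) : 0 < (1 - (2 : ℝ) ^ (-b)) / b := by
  rcases hb.lt_or_gt with h | h
  · exact div_pos_of_neg_of_neg
      (sub_neg.2 (Real.one_lt_rpow one_lt_two (by linarith))) h
  · exact div_pos (sub_pos.2 (Real.rpow_lt_one_of_one_lt_of_neg one_lt_two (by linarith))) h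

/-- The weighted `L^q` norm of a power function on a dyadic annulus. -/
theorem pieceNorm_norm_rpow {d : ℕ} (hd : 1 ≤ d) {γ : ℝ} {ω : Ed d → ℝ} (hω : IsWeight d γ ω)
    {q β : ℝ} (hq : 0 < q) (hβ : β ≠ 0) (k : ℤ) :
    pieceNorm d q ω (fun x : Ed d => ((‖x‖ ^ (β - ((d : ℝ) + γ) / q) : ℝ) : ℂ)) k =
      ENNReal.ofReal ((2 : ℝ) ^ ((k : ℝ) * β)) *
        (ENNReal.ofReal (((1 - (2 : ℝ) ^ (-(q * β))) / (q * β)) ^ (1 / q)) *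
          sphereInt d ω ^ (1 / q)) := by
  have : NeZero d := ⟨by lia⟩
  have hqβ : q * β ≠ 0 := mul_ne_zero hq.ne' hβ
  have hann : MeasurableSet (annulus d k) :=
    (measurableSet_le measurable_norm measurable_const).diff
      (measurableSet_le measurable_norm measurable_const)
  have h0 : (0 : ℝ) < (2 : ℝ) ^ (k - 1) := by positivity
  set I : Set ℝ := Ioc ((2 : ℝ) ^ (k - 1)) ((2 : ℝ) ^ k) with hI
  have hmem (x : Ed d) : x ∈ annulus d k ↔ ‖x‖ ∈ I := by
    simp [annulus, hI, and_comm]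
  have hmeas := hω.measurable
  have key : ∫⁻ x in annulus d k,
      (‖((‖x‖ ^ (β - ((d : ℝ) + γ) / q) : ℝ) : ℂ)‖₊ : ℝ≥0∞) ^ q * ENNReal.ofReal (ω x) =
      sphereInt d ω * ENNReal.ofReal ((2 : ℝ) ^ ((k : ℝ) * (q * β)) *
        ((1 - (2 : ℝ) ^ (-(q * β))) / (q * β))) := by
    rw [← lintegral_dyadic_rpow hqβ, ← lintegral_indicator hann]
    calc
      _ = ∫⁻ x : Ed d, ENNReal.ofReal (ω (‖x‖⁻¹ • x)) *
            I.indicator (fun r ↦ ENNReal.ofReal (r ^ (q * β - d))) ‖x‖ := by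
        refine lintegral_congr fun x ↦ ?_
        by_cases hx : x ∈ annulus d k
        · have hxI := (hmem x).1 hx
          have hpos : 0 < ‖x‖ := h0.trans hxI.1
          have hexp : (β - ((d : ℝ) + γ) / q) * q = q * β - d + -γ := by field_simp; ring
          have hnorm : ‖((‖x‖ ^ (β - ((d : ℝ) + γ) / q) : ℝ) : ℂ)‖ =
              ‖x‖ ^ (β - ((d : ℝ) + γ) / q) := by
            rw [Complex.norm_real, Real.norm_of_nonneg (by positivity)]
          rw [indicator_of_mem hx, indicator_of_mem hxI, ← enorm_eq_nnnorm, ← ofReal_norm, hnorm,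
            ENNReal.ofReal_rpow_of_pos (by positivity), ← Real.rpow_mul hpos.le, hexp,
            ← ENNReal.ofReal_mul (by positivity), ← ENNReal.ofReal_mul (hω.nonneg _),
            hω.homog _ (inv_pos.2 hpos).ne', abs_of_pos (inv_pos.2 hpos),
            Real.inv_rpow hpos.le, ← Real.rpow_neg hpos.le, Real.rpow_add hpos]
          congr 1
          ring
        · rw [indicator_of_notMem hx, indicator_of_notMem (fun h ↦ hx ((hmem x).2 h)), mul_zero]
      _ = sphereInt d ω * ∫⁻ r in Ioi (0 : ℝ), ENNReal.ofReal (r ^ (d - 1)) *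
            I.indicator (fun r ↦ ENNReal.ofReal (r ^ (q * β - d))) r := by
        rw [lintegral_angular_mul_radial volume (G := fun x ↦ ENNReal.ofReal (ω x))
          (by fun_prop) (Measurable.indicator (by fun_prop) measurableSet_Ioc)]
        simp [sphereInt, hI]
      _ = _ := by
        congr 1
        rw [← lintegral_indicator measurableSet_Ioi, ← lintegral_indicator measurableSet_Ioc]
        refine lintegral_congr fun r ↦ ?_
        by_cases hr : r ∈ I
        · have hpos : 0 < r := h0.trans hr.1
          rw [indicator_of_mem (mem_Ioi.2 hpos), indicator_of_mem hr, indicator_of_mem hr,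
            ← ENNReal.ofReal_mul (by positivity), ← Real.rpow_natCast, ← Real.rpow_add hpos,
            Nat.cast_sub hd]
          congr 2
          push_cast
          ring
        · rw [indicator_of_notMem hr, indicator_apply, indicator_of_notMem hr, mul_zero, ite_self]
  have hc := one_sub_two_rpow_neg_div_pos hqβ
  have h2 : ((2 : ℝ) ^ ((k : ℝ) * (q * β))) ^ (1 / q) = (2 : ℝ) ^ ((k : ℝ) * β) := by
    rw [← Real.rpow_mul two_pos.le]
    congr 1
    field_simp
  rw [pieceNorm, key, ENNReal.mul_rpow_of_nonneg _ _ (by positivity),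
    ENNReal.ofReal_rpow_of_pos (by positivity), Real.mul_rpow (by positivity) hc.le, h2,
    ENNReal.ofReal_mul (by positivity)]
  ring

/-- The integers bounded above by `k₀` are the `k₀ - n` with `n` natural. -/
def natEquivIntLE (k₀ : ℤ) : ℕ ≃ {k : ℤ // k ≤ k₀} where
  toFun n := ⟨k₀ - n, by lia⟩
  invFun k := (k₀ - k.1).toNat
  left_inv n := by simp
  right_inv k := by
    ext
    have := k.2
    simp only
    lia

/-- The sum of a geometric progression over the integers bounded above by `k₀`. -/
theorem tsum_two_rpow_le {a : ℝ} (ha : 0 < a) (k₀ : ℤ) :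
    ∑' k : {k : ℤ // k ≤ k₀}, ENNReal.ofReal ((2 : ℝ) ^ (((k : ℤ) : ℝ) * a)) =
      ENNReal.ofReal ((2 : ℝ) ^ ((k₀ : ℝ) * a) * ((2 : ℝ) ^ a / ((2 : ℝ) ^ a - 1))) := by
  have h1 : (2 : ℝ) ^ (-a) < 1 := Real.rpow_lt_one_of_one_lt_of_neg one_lt_two (by linarith)
  have h2 : (1 : ℝ) < 2 ^ a := Real.one_lt_rpow one_lt_two ha
  have hterm (n : ℕ) : ENNReal.ofReal ((2 : ℝ) ^ (((natEquivIntLE k₀ n : ℤ) : ℝ) * a)) =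
      ENNReal.ofReal ((2 : ℝ) ^ ((k₀ : ℝ) * a)) * ENNReal.ofReal ((2 : ℝ) ^ (-a)) ^ n := by
    rw [← ENNReal.ofReal_pow (by positivity), ← ENNReal.ofReal_mul (by positivity),
      ← Real.rpow_natCast, ← Real.rpow_mul two_pos.le, ← Real.rpow_add two_pos]
    congr 2
    simp only [natEquivIntLE, Equiv.coe_fn_mk]
    push_cast
    ring
  rw [← (natEquivIntLE k₀).tsum_eq]
  simp_rw [hterm]
  rw [ENNReal.tsum_mul_left, ENNReal.tsum_geometric, ← ENNReal.ofReal_one,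
    ← ENNReal.ofReal_sub _ (by positivity), ← ENNReal.ofReal_inv_of_pos (by linarith),
    ← ENNReal.ofReal_mul (by positivity)]
  congr 2
  have h3 : (2 : ℝ) ^ a - 1 ≠ 0 := by linarith
  rw [Real.rpow_neg two_pos.le]
  field_simp

/-- Exact Morrey–Herz norm of the power function `|x|^{-α-(d+γ)/q+lam}`. -/
theorem statement13
    (d : ℕ) (hd : 1 ≤ d) (γ : ℝ) (hγ : -(d : ℝ) < γ)
    (ω : Ed d → ℝ) (hω : IsWeight d γ ω)
    (α p q lam : ℝ) (hp : 0 < p) (hq : 1 ≤ q) (hlam : 0 < lam) (hlamα : lam ≠ α) :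
    morreyHerzNorm d α lam p q ω
        (fun x : Ed d => ((‖x‖ ^ (-α - ((d : ℝ) + γ) / q + lam) : ℝ) : ℂ)) =
      ENNReal.ofReal
          ((2 : ℝ) ^ lam / ((2 : ℝ) ^ (lam * p) - 1) ^ (1 / p) *
            ((1 - (2 : ℝ) ^ (-(q * (lam - α)))) / (q * (lam - α))) ^ (1 / q)) *
        sphereInt d ω ^ (1 / q) := by
  have hq0 : 0 < q := by linarith
  have hβ : lam - α ≠ 0 := sub_ne_zero.2 hlamα
  have hc := one_sub_two_rpow_neg_div_pos (mul_ne_zero hq0.ne' hβ)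
  have hD : 0 < (2 : ℝ) ^ (lam * p) - 1 :=
    sub_pos.2 (Real.one_lt_rpow one_lt_two (by positivity))
  have hf : -α - ((d : ℝ) + γ) / q + lam = lam - α - ((d : ℝ) + γ) / q := by ring
  rw [hf, morreyHerzNorm]
  simp_rw [pieceNorm_norm_rpow hd hω hq0 hβ]
  set A : ℝ := ((1 - (2 : ℝ) ^ (-(q * (lam - α)))) / (q * (lam - α))) ^ (1 / q) with hA
  set M : ℝ≥0∞ := ENNReal.ofReal A * sphereInt d ω ^ (1 / q) with hM
  have hterm (k : ℤ) : ENNReal.ofReal ((2 : ℝ) ^ ((k : ℝ) * α * p)) *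
      (ENNReal.ofReal ((2 : ℝ) ^ ((k : ℝ) * (lam - α))) * M) ^ p =
      ENNReal.ofReal ((2 : ℝ) ^ ((k : ℝ) * (lam * p))) * M ^ p := by
    rw [ENNReal.mul_rpow_of_nonneg _ _ hp.le, ENNReal.ofReal_rpow_of_pos (by positivity),
      ← Real.rpow_mul two_pos.le, ← mul_assoc, ← ENNReal.ofReal_mul (by positivity),
      ← Real.rpow_add two_pos]
    congr 3
    ring
  have hk (k₀ : ℤ) : ENNReal.ofReal ((2 : ℝ) ^ (-(k₀ : ℝ) * lam)) *
      (∑' k : {k : ℤ // k ≤ k₀}, ENNReal.ofReal ((2 : ℝ) ^ (((k : ℤ) : ℝ) * α * p)) *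
        (ENNReal.ofReal ((2 : ℝ) ^ (((k : ℤ) : ℝ) * (lam - α))) * M) ^ p) ^ (1 / p) =
      ENNReal.ofReal ((2 : ℝ) ^ lam / ((2 : ℝ) ^ (lam * p) - 1) ^ (1 / p)) * M := by
    have h1 (t : ℝ) : ((2 : ℝ) ^ (t * p)) ^ (1 / p) = (2 : ℝ) ^ t := by
      rw [← Real.rpow_mul two_pos.le]
      congr 1
      field_simp
    simp_rw [hterm]
    rw [ENNReal.tsum_mul_right, tsum_two_rpow_le (by positivity),
      ENNReal.mul_rpow_of_nonneg _ _ (by positivity), ← ENNReal.rpow_mul,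
      mul_one_div_cancel hp.ne', ENNReal.rpow_one, ENNReal.ofReal_rpow_of_pos (by positivity),
      ← mul_assoc, ← ENNReal.ofReal_mul (by positivity),
      Real.mul_rpow (by positivity) (by positivity), Real.div_rpow (by positivity) hD.le,
      ← mul_assoc (k₀ : ℝ), h1, h1, ← mul_assoc ((2 : ℝ) ^ (-(k₀ : ℝ) * lam)),
      ← Real.rpow_add two_pos, neg_mul, neg_add_cancel, Real.rpow_zero, one_mul]
  simp_rw [hk]
  rw [ciSup_const, hM, ← mul_assoc, ← ENNReal.ofReal_mul (by positivity)]

end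
end

section
/- Let d ≥ 1, γ > −d, ω ∈ W_γ, α ∈ ℝ, 0 < p < ∞, 1 ≤ q < ∞, and 0 < ε < 1 with α + ε ≠ 0. Define f(x) = 0 for |x| ≤ 1 and f(x) = |x|^{−α−(d+γ)/q−ε} for |x| > 1. Then ‖f‖_{K̇^{α,p}_q(ω)} = (1/(2^{εp}−1)^{1/p}) · ((2^{q(α+ε)}−1)/(q(α+ε)))^{1/q} · (∫_{S_d} ω dσ)^{1/q}; in particular f has finite Herz norm. -/
open MeasureTheory ENNReal Set

noncomputable section

/-- Polar coordinates for a radial function times a homogeneous weight. -/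
theorem lintegral_norm_mul_weight {d : ℕ} {γ : ℝ} {ω : Ed d → ℝ} (hd : 1 ≤ d)
    (hω : IsWeight d γ ω) {g : ℝ → ℝ≥0∞} (hg : Measurable g) :
    ∫⁻ x, g ‖x‖ * ENNReal.ofReal (ω x) =
      sphereInt d ω *
        ∫⁻ r in Ioi (0 : ℝ), ENNReal.ofReal (r ^ (d - 1)) * (g r * ENNReal.ofReal (r ^ γ)) := by
  have : Nonempty (Fin d) := ⟨⟨0, hd⟩⟩
  have hωm := hω.measurable
  calc
    ∫⁻ x, g ‖x‖ * ENNReal.ofReal (ω x)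
      = ∫⁻ x : ({(0)}ᶜ : Set (Ed d)), g ‖x.1‖ * ENNReal.ofReal (ω x.1)
          ∂((volume : Measure (Ed d)).comap (↑)) := by
        rw [lintegral_subtype_comap (measurableSet_singleton _).compl
          fun x ↦ g ‖x‖ * ENNReal.ofReal (ω x), restrict_compl_singleton]
    _ = ∫⁻ x : ({(0)}ᶜ : Set (Ed d)),
          (fun z : Metric.sphere (0 : Ed d) 1 × Ioi (0 : ℝ) ↦
            ENNReal.ofReal (ω z.1) * (g z.2 * ENNReal.ofReal ((z.2 : ℝ) ^ γ)))
            (homeomorphUnitSphereProd (Ed d) x) ∂((volume : Measure (Ed d)).comap (↑)) := by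
        refine lintegral_congr fun x ↦ ?_
        have hx : 0 < ‖x.1‖ := norm_pos_iff.2 x.2
        have h : ω x.1 = ‖x.1‖ ^ γ * ω (‖x.1‖⁻¹ • x.1) := by
          rw [← abs_of_pos hx, ← hω.homog _ (abs_of_pos hx ▸ hx.ne'), abs_of_pos hx,
            smul_inv_smul₀ hx.ne']
        simp only [homeomorphUnitSphereProd_apply_snd_coe,
          homeomorphUnitSphereProd_apply_fst_coe]
        rw [h, ENNReal.ofReal_mul (by positivity)]
        ring
    _ = ∫⁻ z, ENNReal.ofReal (ω z.1) * (g z.2 * ENNReal.ofReal ((z.2 : ℝ) ^ γ))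
          ∂((volume : Measure (Ed d)).toSphere.prod
            (Measure.volumeIoiPow (Module.finrank ℝ (Ed d) - 1))) :=
        (volume : Measure (Ed d)).measurePreserving_homeomorphUnitSphereProd.lintegral_comp_emb
          (Homeomorph.measurableEmbedding _) fun z : Metric.sphere (0 : Ed d) 1 × Ioi (0 : ℝ) ↦
            ENNReal.ofReal (ω z.1) * (g z.2 * ENNReal.ofReal ((z.2 : ℝ) ^ γ))
    _ = sphereInt d ω * ∫⁻ r : Ioi (0 : ℝ), g r * ENNReal.ofReal ((r : ℝ) ^ γ)
          ∂(Measure.volumeIoiPow (Module.finrank ℝ (Ed d) - 1)) := by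
        rw [lintegral_prod_mul (f := fun θ : Metric.sphere (0 : Ed d) 1 ↦ ENNReal.ofReal (ω θ))
          (g := fun r : Ioi (0 : ℝ) ↦ g r * ENNReal.ofReal ((r : ℝ) ^ γ))
          (by fun_prop) (by fun_prop), sphereInt]
    _ = _ := by
        rw [Measure.volumeIoiPow, lintegral_withDensity_eq_lintegral_mul _ (by fun_prop)
          (by fun_prop), finrank_euclideanSpace_fin]
        exact congrArg _ (lintegral_subtype_comap measurableSet_Ioi
          fun r : ℝ ↦ ENNReal.ofReal (r ^ (d - 1)) * (g r * ENNReal.ofReal (r ^ γ)))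

theorem lintegral_Ioc_rpow_neg_one_sub {a b c : ℝ} (ha : 0 < a) (hab : a ≤ b) (hc : c ≠ 0) :
    ∫⁻ r in Ioc a b, ENNReal.ofReal (r ^ (-1 - c)) =
      ENNReal.ofReal ((a ^ (-c) - b ^ (-c)) / c) := by
  have h0 : (0 : ℝ) ∉ uIcc a b := by
    rw [uIcc_of_le hab]
    exact fun h ↦ ha.not_ge h.1
  rw [← ofReal_integral_eq_lintegral_ofReal
      (intervalIntegral.intervalIntegrable_rpow (Or.inr h0)).1
      (by filter_upwards [ae_restrict_mem measurableSet_Ioc] with r hr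
          exact Real.rpow_nonneg (ha.trans hr.1).le _),
    ← intervalIntegral.integral_of_le hab,
    integral_rpow (Or.inr ⟨fun h ↦ hc (by linarith), h0⟩)]
  congr 1
  rw [show -1 - c + 1 = -c by ring]
  field_simp
  ring

theorem annulus_eq_preimage_norm (d : ℕ) (k : ℤ) :
    annulus d k = (fun x : Ed d ↦ ‖x‖) ⁻¹' Ioc ((2 : ℝ) ^ (k - 1)) (2 ^ k) := by
  ext x
  simp [annulus, and_comm]

theorem two_rpow_sub_one_div_pos {c : ℝ} (hc : c ≠ 0) : 0 < ((2 : ℝ) ^ c - 1) / c := by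
  rcases hc.lt_or_gt with h | h
  · exact div_pos_of_neg_of_neg
      (sub_neg.2 (Real.rpow_lt_one_of_one_lt_of_neg one_lt_two h)) h
  · exact div_pos (sub_pos.2 (Real.one_lt_rpow one_lt_two h)) h

/-- The weighted `L^q` mass of the truncated power `|x|^{-β - (d+γ)/q}` on a dyadic annulus
outside the unit ball. -/
theorem lintegral_annulus_power {d : ℕ} {γ β q : ℝ} {ω : Ed d → ℝ} (hd : 1 ≤ d)
    (hω : IsWeight d γ ω) (hq : 0 < q) (hβ : β ≠ 0) {k : ℤ} (hk : 1 ≤ k) :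
    ∫⁻ x in annulus d k,
        (‖(if ‖x‖ ≤ 1 then 0 else ((‖x‖ ^ (-β - ((d : ℝ) + γ) / q) : ℝ) : ℂ))‖₊ : ℝ≥0∞) ^ q *
          ENNReal.ofReal (ω x) =
      ENNReal.ofReal ((2 : ℝ) ^ (-(k * β) * q) * (((2 : ℝ) ^ (q * β) - 1) / (q * β))) *
        sphereInt d ω := by
  set I := Ioc ((2 : ℝ) ^ (k - 1)) (2 ^ k) with hI
  have hone : (1 : ℝ) ≤ 2 ^ (k - 1) := one_le_zpow₀ one_le_two (by omega)
  have hIm : MeasurableSet I := measurableSet_Ioc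
  set s : ℝ := -β - ((d : ℝ) + γ) / q with hs
  set g : ℝ → ℝ≥0∞ := I.indicator fun r ↦ ENNReal.ofReal (r ^ (s * q)) with hg
  have hgm : Measurable g := Measurable.indicator (by fun_prop) hIm
  have hA : MeasurableSet (annulus d k) := by
    rw [annulus_eq_preimage_norm]
    exact measurable_norm hIm
  rw [← lintegral_indicator hA]
  have hcongr : ∀ x : Ed d, (annulus d k).indicator (fun x ↦
      (‖(if ‖x‖ ≤ 1 then 0 else ((‖x‖ ^ s : ℝ) : ℂ))‖₊ : ℝ≥0∞) ^ q *
          ENNReal.ofReal (ω x)) x = g ‖x‖ * ENNReal.ofReal (ω x) := by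
    intro x
    by_cases hx : x ∈ annulus d k
    · have hx' : ‖x‖ ∈ I := by rwa [annulus_eq_preimage_norm] at hx
      have h1 : 1 < ‖x‖ := hone.trans_lt hx'.1
      rw [indicator_of_mem hx, hg, indicator_of_mem hx', if_neg h1.not_ge, ← enorm_eq_nnnorm,
        ← ofReal_norm, Complex.norm_real, Real.norm_of_nonneg (by positivity),
        ENNReal.ofReal_rpow_of_nonneg (by positivity) hq.le, Real.rpow_mul (by positivity)]
    · have hx' : ‖x‖ ∉ I := by rwa [annulus_eq_preimage_norm] at hx
      rw [indicator_of_notMem hx, hg, indicator_of_notMem hx', zero_mul]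
  rw [lintegral_congr hcongr, lintegral_norm_mul_weight hd hω hgm, mul_comm]
  congr 1
  have hcongr' : ∀ r ∈ Ioi (0 : ℝ), ENNReal.ofReal (r ^ (d - 1)) *
      (g r * ENNReal.ofReal (r ^ γ)) =
        I.indicator (fun r ↦ ENNReal.ofReal (r ^ (-1 - q * β))) r := by
    intro r hr
    have hr : 0 < r := hr
    by_cases hrI : r ∈ I
    · rw [hg, indicator_of_mem hrI, indicator_of_mem hrI,
        ← ENNReal.ofReal_mul (by positivity), ← ENNReal.ofReal_mul (by positivity),
        ← Real.rpow_natCast, ← Real.rpow_add hr, ← Real.rpow_add hr, Nat.cast_sub hd, hs]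
      congr 2
      push_cast
      field_simp
      ring
    · rw [hg, indicator_of_notMem hrI, indicator_of_notMem hrI, zero_mul, mul_zero]
  have hsub : I ∩ Ioi 0 = I :=
    inter_eq_left.2 fun r hr ↦ (zero_lt_one.trans_le hone).trans hr.1
  rw [setLIntegral_congr_fun measurableSet_Ioi hcongr', lintegral_indicator hIm,
    Measure.restrict_restrict hIm, hsub, hI,
    lintegral_Ioc_rpow_neg_one_sub (by positivity)
      (zpow_le_zpow_right₀ one_le_two (by omega)) (mul_ne_zero hq.ne' hβ)]
  congr 1
  rw [← Real.rpow_intCast, ← Real.rpow_intCast, ← Real.rpow_mul zero_le_two,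
    ← Real.rpow_mul zero_le_two, ← mul_div_assoc, mul_sub, ← Real.rpow_add two_pos]
  push_cast
  congr 2 <;> ring_nf

theorem pieceNorm_power {d : ℕ} {γ β q : ℝ} {ω : Ed d → ℝ} (hd : 1 ≤ d)
    (hω : IsWeight d γ ω) (hq : 0 < q) (hβ : β ≠ 0) {k : ℤ} (hk : 1 ≤ k) :
    pieceNorm d q ω (fun x : Ed d ↦
        if ‖x‖ ≤ 1 then 0 else ((‖x‖ ^ (-β - ((d : ℝ) + γ) / q) : ℝ) : ℂ)) k =
      ENNReal.ofReal ((2 : ℝ) ^ (-(k * β))) *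
        (ENNReal.ofReal ((((2 : ℝ) ^ (q * β) - 1) / (q * β)) ^ (1 / q)) *
          sphereInt d ω ^ (1 / q)) := by
  have hA := two_rpow_sub_one_div_pos (mul_ne_zero hq.ne' hβ)
  rw [pieceNorm, lintegral_annulus_power hd hω hq hβ hk,
    ENNReal.mul_rpow_of_nonneg _ _ (by positivity),
    ENNReal.ofReal_rpow_of_nonneg (by positivity) (by positivity),
    Real.mul_rpow (by positivity) hA.le, ← Real.rpow_mul zero_le_two,
    mul_assoc _ q, mul_one_div_cancel hq.ne', mul_one, ENNReal.ofReal_mul (by positivity),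
    mul_assoc]

theorem pieceNorm_eq_zero_of_nonpos {d : ℕ} {q : ℝ} {ω : Ed d → ℝ} (hq : 0 < q) (h : Ed d → ℂ)
    {k : ℤ} (hk : k ≤ 0) :
    pieceNorm d q ω (fun x : Ed d ↦ if ‖x‖ ≤ 1 then 0 else h x) k = 0 := by
  have hA : MeasurableSet (annulus d k) := by
    rw [annulus_eq_preimage_norm]
    exact measurable_norm measurableSet_Ioc
  rw [pieceNorm, setLIntegral_congr_fun (g := 0) hA, Pi.zero_def, lintegral_zero,
    ENNReal.zero_rpow_of_pos (by positivity)]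
  intro x hx
  have h1 : ‖x‖ ≤ 1 := hx.1.trans (zpow_le_one_of_nonpos₀ one_le_two hk)
  simp [h1, hq]

theorem tsum_ofReal_two_rpow_neg_succ {t : ℝ} (ht : 0 < t) :
    ∑' n : ℕ, ENNReal.ofReal ((2 : ℝ) ^ (-((n : ℝ) + 1) * t)) =
      ENNReal.ofReal (1 / ((2 : ℝ) ^ t - 1)) := by
  have hx : (2 : ℝ) ^ (-t) < 1 := Real.rpow_lt_one_of_one_lt_of_neg one_lt_two (by linarith)
  have hx0 : (0 : ℝ) < 2 ^ (-t) := by positivity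
  have hterm : ∀ n : ℕ, (2 : ℝ) ^ (-((n : ℝ) + 1) * t) = 2 ^ (-t) * (2 ^ (-t)) ^ n := by
    intro n
    rw [← Real.rpow_natCast, ← Real.rpow_mul zero_le_two, ← Real.rpow_add two_pos]
    ring_nf
  simp only [hterm]
  rw [← ENNReal.ofReal_tsum_of_nonneg (fun n ↦ by positivity)
    ((summable_geometric_of_lt_one hx0.le hx).mul_left _), tsum_mul_left,
    tsum_geometric_of_lt_one hx0.le hx]
  have h1 : (1 : ℝ) < 2 ^ t := Real.one_lt_rpow one_lt_two ht
  congr 1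
  rw [Real.rpow_neg zero_le_two] at hx ⊢
  have h2 : (2 : ℝ) ^ t - 1 ≠ 0 := (sub_pos.2 h1).ne'
  field_simp

/-- Exact Herz norm of the truncated power function. -/
theorem statement14
    (d : ℕ) (hd : 1 ≤ d) (γ : ℝ) (hγ : -(d : ℝ) < γ)
    (ω : Ed d → ℝ) (hω : IsWeight d γ ω)
    (α p q ε : ℝ) (hp : 0 < p) (hq : 1 ≤ q) (hε : 0 < ε ∧ ε < 1) (hαε : α + ε ≠ 0) :
    herzNorm d α p q ω
          (fun x : Ed d =>
            if ‖x‖ ≤ 1 then 0 else ((‖x‖ ^ (-α - ((d : ℝ) + γ) / q - ε) : ℝ) : ℂ)) =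
        ENNReal.ofReal
            (1 / ((2 : ℝ) ^ (ε * p) - 1) ^ (1 / p) *
              (((2 : ℝ) ^ (q * (α + ε)) - 1) / (q * (α + ε))) ^ (1 / q)) *
          sphereInt d ω ^ (1 / q) ∧
      herzNorm d α p q ω
          (fun x : Ed d =>
            if ‖x‖ ≤ 1 then 0 else ((‖x‖ ^ (-α - ((d : ℝ) + γ) / q - ε) : ℝ) : ℂ)) < ⊤ := by
  obtain ⟨hε, -⟩ := hε
  have hq0 : 0 < q := zero_lt_one.trans_le hq
  refine and_iff_left_of_imp (fun h ↦ ?_) |>.2 ?_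
  · rw [h]
    exact ENNReal.mul_lt_top ENNReal.ofReal_lt_top
      (ENNReal.rpow_lt_top_of_nonneg (by positivity) hω.sphere_lt_top.ne)
  have hexp : -α - ((d : ℝ) + γ) / q - ε = -(α + ε) - ((d : ℝ) + γ) / q := by ring
  simp only [hexp]
  set M := ENNReal.ofReal ((((2 : ℝ) ^ (q * (α + ε)) - 1) / (q * (α + ε))) ^ (1 / q)) *
    sphereInt d ω ^ (1 / q) with hM
  have hinj : Function.Injective fun n : ℕ ↦ (n : ℤ) + 1 := fun m n h ↦ by
    simpa using h
  have h1 : (1 : ℝ) < 2 ^ (ε * p) := Real.one_lt_rpow one_lt_two (by positivity)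
  have h2 : (0 : ℝ) ≤ 2 ^ (ε * p) - 1 := by linarith
  rw [herzNorm, ← hinj.tsum_eq]
  · have hterm : ∀ n : ℕ, ENNReal.ofReal ((2 : ℝ) ^ ((((n : ℤ) + 1 : ℤ) : ℝ) * α * p)) *
        pieceNorm d q ω (fun x : Ed d ↦ if ‖x‖ ≤ 1 then 0 else
          ((‖x‖ ^ (-(α + ε) - ((d : ℝ) + γ) / q) : ℝ) : ℂ)) ((n : ℤ) + 1) ^ p =
        ENNReal.ofReal ((2 : ℝ) ^ (-((n : ℝ) + 1) * (ε * p))) * M ^ p := by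
      intro n
      rw [pieceNorm_power hd hω hq0 hαε (by omega), ← hM,
        ENNReal.mul_rpow_of_nonneg _ _ hp.le,
        ENNReal.ofReal_rpow_of_nonneg (by positivity) hp.le, ← mul_assoc,
        ← ENNReal.ofReal_mul (by positivity), ← Real.rpow_mul zero_le_two,
        ← Real.rpow_add two_pos]
      push_cast
      ring_nf
    simp only [hterm]
    rw [ENNReal.tsum_mul_right, tsum_ofReal_two_rpow_neg_succ (by positivity),
      ENNReal.mul_rpow_of_nonneg _ _ (by positivity), ← ENNReal.rpow_mul,
      mul_one_div_cancel hp.ne', ENNReal.rpow_one,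
      ENNReal.ofReal_rpow_of_nonneg (by positivity) (by positivity),
      Real.div_rpow zero_le_one h2, Real.one_rpow, ENNReal.ofReal_mul (by positivity), mul_assoc]
  · intro k hk
    by_contra hk'
    have hk0 : k ≤ 0 := by
      by_contra! h
      exact hk' ⟨(k - 1).toNat, by simp only; omega⟩
    refine hk ?_
    simp only
    rw [pieceNorm_eq_zero_of_nonpos hq0 _ hk0, ENNReal.zero_rpow_of_pos hp, mul_zero]

end
end
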